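/- arXiv:math/0110167 — 2 statements merged into one kernel-verified Lean document; each statement's English description precedes it below -/
import Mathlib

section
/- Let T be a finite tree on a vertex set V with |V| ≥ 2, with integer vertex weights, and let A be the associated intersection matrix (diagonal entries the weights, off-diagonal entries 1 for adjacent vertices and 0 otherwise), assumed negative definite. If x ∈ ℤ^V does not lie in A·ℤ^V, then there exist at least two distinct leaves w of T for which (A⁻¹x)_w is not an integer. Equivalently, the diagonal action of the discriminant group ℤ^V/Aℤ^V on ℂ^{ends}, in which the class of x acts by multiplying the coordinate of each leaf w by exp(2πi (A⁻¹x)_w), is free in codimension 1: no coordinate hyperplane is fixed pointwise by a non-trivial group element. -/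
open Matrix

namespace SimpleGraph

variable {V : Type*} {G : SimpleGraph V}

/-- In a tree rooted at `r`, a vertex has at most one neighbour closer to the root. -/
theorem IsTree.eq_of_adj_of_dist_add_one_eq (hG : G.IsTree) {r u v w : V}
    (huw : G.Adj u w) (hvw : G.Adj v w)
    (hu : G.dist r u + 1 = G.dist r w) (hv : G.dist r v + 1 = G.dist r w) : u = v := by
  obtain ⟨p, -, hp⟩ := hG.connected.exists_path_of_dist r u
  obtain ⟨q, -, hq⟩ := hG.connected.exists_path_of_dist r v
  have hp' : (p.concat huw).IsPath :=
    Walk.isPath_of_length_eq_dist _ (by rw [Walk.length_concat, hp, hu])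
  have hq' : (q.concat hvw).IsPath :=
    Walk.isPath_of_length_eq_dist _ (by rw [Walk.length_concat, hq, hv])
  have h : p.concat huw = q.concat hvw :=
    congrArg Subtype.val ((hG.isAcyclic.subsingleton_path r w).elim ⟨_, hp'⟩ ⟨_, hq'⟩)
  simpa using congrArg Walk.penultimate h

/-- In a rooted tree with at least two vertices, every vertex which is the root or not a leaf has
a neighbour farther from the root. -/
theorem IsTree.exists_adj_dist_eq_add_one [Nontrivial V] (hG : G.IsTree) {r v : V}
    [Fintype (G.neighborSet v)] (hv : v = r ∨ G.degree v ≠ 1) :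
    ∃ c, G.Adj v c ∧ G.dist r c = G.dist r v + 1 := by
  have hpos := hG.connected.preconnected.degree_pos_of_nontrivial v
  obtain ⟨a, ha⟩ := (G.degree_pos_iff_exists_adj v).1 hpos
  rcases hG.dist_eq_dist_add_one_of_adj r ha with h | h
  · rcases hv with rfl | hv
    · simp at h
    have hcard : 1 < (G.neighborFinset v).card := by
      rw [card_neighborFinset_eq_degree]
      omega
    obtain ⟨b, hb, hba⟩ := Finset.exists_mem_ne hcard a
    rw [mem_neighborFinset] at hb
    rcases hG.dist_eq_dist_add_one_of_adj r hb with h' | h'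
    · exact absurd (hG.eq_of_adj_of_dist_add_one_eq hb.symm ha.symm h'.symm h.symm) hba
    · exact ⟨b, hb, h'⟩
  · exact ⟨a, ha, h⟩

/-- A property of the vertices of a finite tree that holds at all leaves except possibly one
holds everywhere, provided it passes from a vertex and all but one of its neighbours to the
remaining neighbour. -/
theorem IsTree.forall_of_forall_leaf_ne [Fintype V] [DecidableRel G.Adj] [Nontrivial V]
    (hG : G.IsTree) (P : V → Prop) (r : V) (hleaf : ∀ w, G.degree w = 1 → w ≠ r → P w)
    (hstep : ∀ c v, G.Adj c v → P c → (∀ w, G.Adj c w → w ≠ v → P w) → P v) (v : V) : P v := by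
  by_contra hPv
  obtain ⟨m, hm, hmax⟩ := Set.exists_max_image {v | ¬ P v} (G.dist r) (Set.toFinite _) ⟨v, hPv⟩
  have hP : ∀ w, G.dist r m < G.dist r w → P w := fun w hw ↦
    by_contra fun h ↦ absurd (hmax w h) hw.not_ge
  have hm' : m = r ∨ G.degree m ≠ 1 := by
    by_contra! h
    exact hm (hleaf m h.2 h.1)
  obtain ⟨c, hmc, hc⟩ := hG.exists_adj_dist_eq_add_one hm'
  refine hm (hstep c m hmc.symm (hP c (by omega)) fun w hcw hwm ↦ hP w ?_)
  rcases hG.dist_eq_dist_add_one_of_adj r hcw with h | h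
  · exact absurd (hG.eq_of_adj_of_dist_add_one_eq hcw.symm hmc h.symm hc.symm) hwm
  · omega

end SimpleGraph

/-- If all but one of the summands `a w * z w` of an integral sum have `a w = 0`, or `a w` and
`z w` integral, then the remaining `z v` is integral when its coefficient is `1`. -/
theorem mem_range_intCast_of_dotProduct {V : Type*} [Fintype V] [DecidableEq V]
    {a z : V → ℝ} {v : V} (hsum : a ⬝ᵥ z ∈ (Int.castRingHom ℝ).range) (hv : a v = 1)
    (h : ∀ w, w ≠ v → a w = 0 ∨
      a w ∈ (Int.castRingHom ℝ).range ∧ z w ∈ (Int.castRingHom ℝ).range) :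
    z v ∈ (Int.castRingHom ℝ).range := by
  have hrest : ∑ w ∈ Finset.univ.erase v, a w * z w ∈ (Int.castRingHom ℝ).range := by
    refine Subring.sum_mem _ fun w hw ↦ ?_
    rcases h w (Finset.ne_of_mem_erase hw) with h | ⟨ha, hz⟩
    · rw [h, zero_mul]
      exact zero_mem _
    · exact mul_mem ha hz
  have := sub_mem hsum hrest
  rwa [dotProduct, ← Finset.add_sum_erase _ _ (Finset.mem_univ v), add_sub_cancel_right, hv,
    one_mul] at this

/-- Let `T` be a finite tree with at least two vertices, with integer vertex weights, and let
`A` be the associated intersection matrix, assumed negative definite.  If an integer vector `x`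
does not lie in `A · ℤ^V`, then there are at least two distinct leaves `w` of `T` at which
`(A⁻¹ x) w` is not an integer.  Equivalently, the diagonal action of the discriminant group
`ℤ^V / Aℤ^V` on the coordinates indexed by the leaves is free in codimension 1: no coordinate
hyperplane is fixed pointwise by a non-trivial group element. -/
theorem tree_discriminant_group_free_in_codimension_one {V : Type*} [Fintype V] [DecidableEq V]
    (G : SimpleGraph V) [DecidableRel G.Adj] (hconn : G.Connected) (hacyc : G.IsAcyclic)
    (hcard : 2 ≤ Fintype.card V) (e : V → ℤ)
    (A : Matrix V V ℝ)
    (hA : ∀ v w, A v w = if v = w then (e v : ℝ) else if G.Adj v w then 1 else 0)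
    (hneg : ∀ y : V → ℝ, y ≠ 0 → y ⬝ᵥ A.mulVec y < 0)
    (x : V → ℤ)
    (hx : ¬ ∃ y : V → ℤ, (fun v => (x v : ℝ)) = A.mulVec fun v => (y v : ℝ)) :
    ∃ w₁ w₂ : V, w₁ ≠ w₂ ∧ G.degree w₁ = 1 ∧ G.degree w₂ = 1 ∧
      (¬ ∃ m : ℤ, A⁻¹.mulVec (fun v => (x v : ℝ)) w₁ = m) ∧
      (¬ ∃ m : ℤ, A⁻¹.mulVec (fun v => (x v : ℝ)) w₂ = m) := by
  have : Nontrivial V := Fintype.one_lt_card_iff_nontrivial.1 hcard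
  have hG : G.IsTree := ⟨hconn, hacyc⟩
  have hdet : IsUnit A.det := by
    rw [isUnit_iff_ne_zero]
    intro h
    obtain ⟨y, hy, hAy⟩ := exists_mulVec_eq_zero_iff.2 h
    simpa [hAy] using hneg y hy
  set z : V → ℝ := A⁻¹ *ᵥ fun v ↦ (x v : ℝ) with hz
  have hAz : A *ᵥ z = fun v ↦ (x v : ℝ) := by
    rw [hz, mulVec_mulVec, mul_nonsing_inv _ hdet, one_mulVec]
  have hroot : ∀ r, ∃ w, G.degree w = 1 ∧ w ≠ r ∧ ¬ ∃ m : ℤ, z w = m := by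
    intro r
    by_contra! hleaf
    have hint := hG.forall_of_forall_leaf_ne (fun v ↦ ∃ m : ℤ, z v = m) r hleaf
      fun c v hcv ⟨m, hm⟩ hnbr ↦ by
        have hsum : A c ⬝ᵥ z ∈ (Int.castRingHom ℝ).range := ⟨x c, (congrFun hAz c).symm⟩
        have hv : A c v = 1 := by rw [hA, if_neg hcv.ne, if_pos hcv]
        obtain ⟨n, hn⟩ := mem_range_intCast_of_dotProduct hsum hv fun w hwv ↦ by
          rw [hA]
          split_ifs with hcw hadj
          · subst hcw
            exact .inr ⟨⟨e c, rfl⟩, ⟨m, hm.symm⟩⟩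
          · obtain ⟨k, hk⟩ := hnbr w hadj hwv
            exact .inr ⟨one_mem _, ⟨k, hk.symm⟩⟩
          · exact .inl rfl
        exact ⟨n, hn.symm⟩
    choose y hy using hint
    exact hx ⟨y, by rw [← hAz, funext hy]⟩
  obtain ⟨w₁, hdeg₁, -, hw₁⟩ := hroot (Classical.arbitrary V)
  obtain ⟨w₂, hdeg₂, hne, hw₂⟩ := hroot w₁
  exact ⟨w₁, w₂, hne.symm, hdeg₁, hdeg₂, hw₁, hw₂⟩
end

section
/- Let 2T be the binary tetrahedral group Δ'(2,3,3), the subgroup of GL₂(ℂ) of order 24 generated by g₁ = [[i,0],[0,−i]], g₂ = [[0,1],[−1,0]], and g₃ = (1/2)·[[−1+i, 1+i],[−1+i, −1−i]], acting on ℂ[x,y] by linear substitution of the variables. Then the invariant subalgebra ℂ[x,y]^{2T} is isomorphic as a ℂ-algebra to ℂ[z₁,z₂,z₃]/(z₁² + z₂³ + z₃⁴), the coordinate ring of the Brieskorn variety V(2,3,4). Hence V(2,3,4) ≅ ℂ²/Δ'(2,3,3). -/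
open MvPolynomial

/-- The ℂ-algebra endomorphism of `ℂ[x,y]` given by the linear substitution of variables by an
invertible 2×2 matrix `M`: `x_i ↦ Σ_j M i j · x_j`. -/
noncomputable def linSubst (M : Matrix (Fin 2) (Fin 2) ℂ) :
    MvPolynomial (Fin 2) ℂ →ₐ[ℂ] MvPolynomial (Fin 2) ℂ :=
  aeval fun i => ∑ j, C (M i j) * X j

/-- The subalgebra of `ℂ[x,y]` of polynomials invariant under linear substitution by all
matrices in a subgroup `G` of `GL₂(ℂ)`. -/
noncomputable def invariantSubalgebra (G : Subgroup (Matrix (Fin 2) (Fin 2) ℂ)ˣ) :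
    Subalgebra ℂ (MvPolynomial (Fin 2) ℂ) :=
  ⨅ u ∈ G, AlgHom.equalizer (linSubst (u : Matrix (Fin 2) (Fin 2) ℂ))
    (AlgHom.id ℂ (MvPolynomial (Fin 2) ℂ))


/-- The matrix of the quaternion whose coordinates are half of the given integers. -/
noncomputable def quatMatrix (q : ℤ × ℤ × ℤ × ℤ) : Matrix (Fin 2) (Fin 2) ℂ :=
  (2⁻¹ : ℂ) • !![q.1 + q.2.1 * Complex.I, q.2.2.1 + q.2.2.2 * Complex.I;
    -q.2.2.1 + q.2.2.2 * Complex.I, q.1 - q.2.1 * Complex.I]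

/-- Left multiplication by the quaternion `i`, in doubled coordinates. -/
def leftMulI (q : ℤ × ℤ × ℤ × ℤ) : ℤ × ℤ × ℤ × ℤ := (-q.2.1, q.1, -q.2.2.2, q.2.2.1)

/-- Left multiplication by the quaternion `j`, in doubled coordinates. -/
def leftMulJ (q : ℤ × ℤ × ℤ × ℤ) : ℤ × ℤ × ℤ × ℤ := (-q.2.2.1, q.2.2.2, q.1, -q.2.1)

/-- Left multiplication by `(-1 + i + j + k) / 2`, in doubled coordinates. -/
def leftMulOmega (q : ℤ × ℤ × ℤ × ℤ) : ℤ × ℤ × ℤ × ℤ :=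
  ((-q.1 - q.2.1 - q.2.2.1 - q.2.2.2) / 2, (q.1 - q.2.1 - q.2.2.1 + q.2.2.2) / 2,
    (q.1 + q.2.1 - q.2.2.1 - q.2.2.2) / 2, (q.1 - q.2.1 + q.2.2.1 - q.2.2.2) / 2)

/-- The units of the Hurwitz quaternions, in doubled coordinates. -/
def hurwitzUnits : Finset (ℤ × ℤ × ℤ × ℤ) :=
  (Finset.univ : Finset (Fin 4 × Fin 2 × Fin 3)).image fun e =>
    leftMulI^[e.1] (leftMulJ^[e.2.1] (leftMulOmega^[e.2.2] (2, 0, 0, 0)))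

theorem card_hurwitzUnits : hurwitzUnits.card = 24 := by decide +kernel

theorem leftMul_mem_hurwitzUnits : ∀ q ∈ hurwitzUnits,
    leftMulI q ∈ hurwitzUnits ∧ leftMulJ q ∈ hurwitzUnits ∧ leftMulOmega q ∈ hurwitzUnits := by
  decide +kernel


theorem even_sum_of_mem_hurwitzUnits :
    ∀ q ∈ hurwitzUnits, (q.1 + q.2.1 + q.2.2.1 + q.2.2.2) % 2 = 0 := by
  decide +kernel

theorem quatMatrix_injective : Function.Injective quatMatrix := by
  rintro ⟨a, b, c, d⟩ ⟨a', b', c', d'⟩ h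
  have h0 := congrFun (congrFun h 0) 0
  have h1 := congrFun (congrFun h 0) 1
  simp [quatMatrix, Complex.ext_iff] at h0 h1
  simp [h0, h1]

theorem quatMatrix_leftMulI (q : ℤ × ℤ × ℤ × ℤ) :
    !![Complex.I, 0; 0, -Complex.I] * quatMatrix q = quatMatrix (leftMulI q) := by
  ext i j
  fin_cases i <;> fin_cases j <;>
    simp [quatMatrix, leftMulI, Matrix.mul_apply, Complex.ext_iff]

theorem quatMatrix_leftMulJ (q : ℤ × ℤ × ℤ × ℤ) :
    !![0, 1; -1, 0] * quatMatrix q = quatMatrix (leftMulJ q) := by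
  ext i j
  fin_cases i <;> fin_cases j <;>
    simp [quatMatrix, leftMulJ, Matrix.mul_apply, Complex.ext_iff]

theorem quatMatrix_leftMulOmega (q : ℤ × ℤ × ℤ × ℤ)
    (hq : (q.1 + q.2.1 + q.2.2.1 + q.2.2.2) % 2 = 0) :
    ((2⁻¹ : ℂ) • !![-1 + Complex.I, 1 + Complex.I; -1 + Complex.I, -1 - Complex.I]) *
      quatMatrix q = quatMatrix (leftMulOmega q) := by
  obtain ⟨a, b, c, d⟩ := q
  obtain ⟨k, hk⟩ := Int.dvd_of_emod_eq_zero hq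
  obtain rfl : a = 2 * k - b - c - d := by simp at hk; omega
  have : leftMulOmega (2 * k - b - c - d, b, c, d) = (-k, k - b - c, k - c - d, k - b - d) := by
    simp only [leftMulOmega, Prod.mk.injEq]
    omega
  rw [this]
  ext i j
  fin_cases i <;> fin_cases j <;>
    simp [quatMatrix, Matrix.mul_apply, Complex.ext_iff] <;> constructor <;> ring

theorem exists_leftMul_eq : ∀ q ∈ hurwitzUnits,
    (∃ q' ∈ hurwitzUnits, leftMulI q' = q) ∧ (∃ q' ∈ hurwitzUnits, leftMulJ q' = q) ∧
      ∃ q' ∈ hurwitzUnits, leftMulOmega q' = q := by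
  decide +kernel

/-- The three generators of the binary tetrahedral group. -/
def tetrahedralGenerators : Set (Matrix (Fin 2) (Fin 2) ℂ)ˣ :=
  {u | (u : Matrix (Fin 2) (Fin 2) ℂ) = !![Complex.I, 0; 0, -Complex.I] ∨
    (u : Matrix (Fin 2) (Fin 2) ℂ) = !![0, 1; -1, 0] ∨
    (u : Matrix (Fin 2) (Fin 2) ℂ) =
      (2⁻¹ : ℂ) • !![-1 + Complex.I, 1 + Complex.I; -1 + Complex.I, -1 - Complex.I]}

theorem quatMatrix_two : quatMatrix (2, 0, 0, 0) = 1 := by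
  ext i j
  fin_cases i <;> fin_cases j <;> simp [quatMatrix]

theorem exists_unit_I :
    ∃ u : (Matrix (Fin 2) (Fin 2) ℂ)ˣ, u.val = !![Complex.I, 0; 0, -Complex.I] := by
  refine (Matrix.isUnit_iff_isUnit_det _).2 ?_
  simp [Matrix.det_fin_two]

theorem exists_unit_J : ∃ u : (Matrix (Fin 2) (Fin 2) ℂ)ˣ, u.val = !![0, 1; -1, 0] := by
  refine (Matrix.isUnit_iff_isUnit_det _).2 ?_
  simp [Matrix.det_fin_two]

theorem exists_unit_omega : ∃ u : (Matrix (Fin 2) (Fin 2) ℂ)ˣ, u.val =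
    (2⁻¹ : ℂ) • !![-1 + Complex.I, 1 + Complex.I; -1 + Complex.I, -1 - Complex.I] := by
  refine (Matrix.isUnit_iff_isUnit_det _).2 (isUnit_iff_ne_zero.2 ?_)
  have : (2⁻¹ * (-1 + Complex.I) * (2⁻¹ * (-1 - Complex.I)) -
      2⁻¹ * (1 + Complex.I) * (2⁻¹ * (-1 + Complex.I)) : ℂ) = 1 := by
    linear_combination (-1 / 2 : ℂ) * Complex.I_sq
  simp [Matrix.det_fin_two, this]

theorem exists_quatMatrix_of_mem_closure {u : (Matrix (Fin 2) (Fin 2) ℂ)ˣ}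
    (hu : u ∈ Subgroup.closure tetrahedralGenerators) :
    ∃ q ∈ hurwitzUnits, u.val = quatMatrix q := by
  induction hu using Subgroup.closure_induction_left with
  | one => exact ⟨(2, 0, 0, 0), by decide +kernel, quatMatrix_two.symm⟩
  | mul_left x hx y hy ih =>
    obtain ⟨q, hq, hyq⟩ := ih
    obtain ⟨h1, h2, h3⟩ := leftMul_mem_hurwitzUnits q hq
    rw [Units.val_mul, hyq]
    obtain hx | hx | hx := hx
    · exact ⟨_, h1, by rw [hx, quatMatrix_leftMulI]⟩
    · exact ⟨_, h2, by rw [hx, quatMatrix_leftMulJ]⟩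
    · exact ⟨_, h3, by rw [hx, quatMatrix_leftMulOmega q (even_sum_of_mem_hurwitzUnits q hq)]⟩
  | inv_mul_cancel x hx y hy ih =>
    obtain ⟨q, hq, hyq⟩ := ih
    obtain ⟨⟨q₁, h1, e1⟩, ⟨q₂, h2, e2⟩, ⟨q₃, h3, e3⟩⟩ := exists_leftMul_eq q hq
    rw [Units.val_mul, hyq]
    obtain hx | hx | hx := hx
    · exact ⟨q₁, h1, by rw [Units.inv_mul_eq_iff_eq_mul, hx, quatMatrix_leftMulI, e1]⟩
    · exact ⟨q₂, h2, by rw [Units.inv_mul_eq_iff_eq_mul, hx, quatMatrix_leftMulJ, e2]⟩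
    · exact ⟨q₃, h3, by rw [Units.inv_mul_eq_iff_eq_mul, hx,
        quatMatrix_leftMulOmega q₃ (even_sum_of_mem_hurwitzUnits q₃ h3), e3]⟩

theorem exists_mem_closure_of_mem_hurwitzUnits {q : ℤ × ℤ × ℤ × ℤ} (hq : q ∈ hurwitzUnits) :
    ∃ u ∈ Subgroup.closure tetrahedralGenerators, u.val = quatMatrix q := by
  obtain ⟨g₁, h₁⟩ := exists_unit_I
  obtain ⟨g₂, h₂⟩ := exists_unit_J
  obtain ⟨g₃, h₃⟩ := exists_unit_omega
  let P : ℤ × ℤ × ℤ × ℤ → Prop := fun q =>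
    q ∈ hurwitzUnits ∧ ∃ u ∈ Subgroup.closure tetrahedralGenerators, u.val = quatMatrix q
  have base : P (2, 0, 0, 0) :=
    ⟨by decide +kernel, 1, one_mem _, quatMatrix_two.symm⟩
  have stepI : ∀ q, P q → P (leftMulI q) := fun q ⟨hq, u, hu, huq⟩ =>
    ⟨(leftMul_mem_hurwitzUnits q hq).1, g₁ * u,
      mul_mem (Subgroup.subset_closure (Or.inl h₁)) hu,
      by rw [Units.val_mul, h₁, huq, quatMatrix_leftMulI]⟩
  have stepJ : ∀ q, P q → P (leftMulJ q) := fun q ⟨hq, u, hu, huq⟩ =>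
    ⟨(leftMul_mem_hurwitzUnits q hq).2.1, g₂ * u,
      mul_mem (Subgroup.subset_closure (Or.inr (Or.inl h₂))) hu,
      by rw [Units.val_mul, h₂, huq, quatMatrix_leftMulJ]⟩
  have stepOmega : ∀ q, P q → P (leftMulOmega q) := fun q ⟨hq, u, hu, huq⟩ =>
    ⟨(leftMul_mem_hurwitzUnits q hq).2.2, g₃ * u,
      mul_mem (Subgroup.subset_closure (Or.inr (Or.inr h₃))) hu,
      by rw [Units.val_mul, h₃, huq,
        quatMatrix_leftMulOmega q (even_sum_of_mem_hurwitzUnits q hq)]⟩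
  have iter : ∀ f : ℤ × ℤ × ℤ × ℤ → ℤ × ℤ × ℤ × ℤ, (∀ q, P q → P (f q)) →
      ∀ (n : ℕ) (q), P q → P (f^[n] q) := fun f hf n q hq =>
    Function.Iterate.rec P hq hf n
  obtain ⟨e, -, rfl⟩ := Finset.mem_image.1 hq
  exact (iter _ stepI _ _ (iter _ stepJ _ _ (iter _ stepOmega _ _ base))).2

theorem card_closure_tetrahedralGenerators :
    Nat.card (Subgroup.closure tetrahedralGenerators) = 24 := by
  have himage : Units.val '' (Subgroup.closure tetrahedralGenerators :
      Set (Matrix (Fin 2) (Fin 2) ℂ)ˣ) = quatMatrix '' hurwitzUnits := by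
    ext M
    constructor
    · rintro ⟨u, hu, rfl⟩
      obtain ⟨q, hq, h⟩ := exists_quatMatrix_of_mem_closure hu
      exact ⟨q, hq, h.symm⟩
    · rintro ⟨q, hq, rfl⟩
      exact exists_mem_closure_of_mem_hurwitzUnits hq
  have h := Set.ncard_image_of_injective
    (Subgroup.closure tetrahedralGenerators : Set (Matrix (Fin 2) (Fin 2) ℂ)ˣ)
    Units.val_injective
  rw [himage, Set.ncard_image_of_injective _ quatMatrix_injective, Set.ncard_coe_finset,
    card_hurwitzUnits] at h
  exact h.symm

section Quaternion

variable {B : Subalgebra ℂ (MvPolynomial (Fin 2) ℂ)}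

theorem powerSum_mem (hu : X 0 ^ 2 * X 1 ^ 2 ∈ B) (hv : X 0 ^ 4 + X 1 ^ 4 ∈ B) (k : ℕ) :
    X 0 ^ (4 * k) + X 1 ^ (4 * k) ∈ B := by
  induction k using Nat.twoStepInduction with
  | zero => simpa using add_mem (one_mem B) (one_mem B)
  | one => simpa using hv
  | more k h₀ h₁ =>
    convert sub_mem (mul_mem hv h₁) (mul_mem (pow_mem hu 2) h₀) using 1
    ring

theorem powerDiff_mem (hu : X 0 ^ 2 * X 1 ^ 2 ∈ B) (hv : X 0 ^ 4 + X 1 ^ 4 ∈ B)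
    (hw : X 0 * X 1 * (X 0 ^ 4 - X 1 ^ 4) ∈ B) (k : ℕ) :
    X 0 * X 1 * (X 0 ^ (4 * k) - X 1 ^ (4 * k)) ∈ B := by
  induction k using Nat.twoStepInduction with
  | zero => simp
  | one => simpa using hw
  | more k h₀ h₁ =>
    convert sub_mem (mul_mem hv h₁) (mul_mem (pow_mem hu 2) h₀) using 1
    ring

theorem symmetrized_mem (hu : X 0 ^ 2 * X 1 ^ 2 ∈ B) (hv : X 0 ^ 4 + X 1 ^ 4 ∈ B)
    (hw : X 0 * X 1 * (X 0 ^ 4 - X 1 ^ 4) ∈ B) (n k : ℕ) :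
    (X 0 * X 1) ^ n * (X 0 ^ (4 * k) + (-1) ^ n * X 1 ^ (4 * k)) ∈ B := by
  obtain ⟨m, rfl | rfl⟩ := Nat.even_or_odd' n
  · convert mul_mem (pow_mem hu m) (powerSum_mem hu hv k) using 1
    simp only [pow_mul _ 2 m]
    simp [mul_pow]
  · convert mul_mem (pow_mem hu m) (powerDiff_mem hu hv hw k) using 1
    simp only [pow_succ, pow_mul _ 2 m]
    simp [mul_pow]
    ring

end Quaternion

/-- Substitution by the generator `diag(i, -i)`. -/
noncomputable abbrev substI := linSubst !![Complex.I, 0; 0, -Complex.I]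

/-- Substitution by the generator `[[0, 1], [-1, 0]]`. -/
noncomputable abbrev substJ := linSubst !![0, 1; -1, 0]

/-- Substitution by the generator of order three. -/
noncomputable abbrev substOmega := linSubst
  ((2⁻¹ : ℂ) • !![-1 + Complex.I, 1 + Complex.I; -1 + Complex.I, -1 - Complex.I])

theorem linSubst_mul (M N : Matrix (Fin 2) (Fin 2) ℂ) :
    linSubst (M * N) = (linSubst N).comp (linSubst M) := by
  ext1 i
  simp [linSubst, Matrix.mul_apply, Fin.sum_univ_two]
  ring

theorem linSubst_one : linSubst 1 = AlgHom.id ℂ _ := by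
  ext1 i
  fin_cases i <;> simp [linSubst, Fin.sum_univ_two]

theorem mem_invariantSubalgebra {G : Subgroup (Matrix (Fin 2) (Fin 2) ℂ)ˣ}
    {f : MvPolynomial (Fin 2) ℂ} :
    f ∈ invariantSubalgebra G ↔ ∀ u ∈ G, linSubst (u : Matrix (Fin 2) (Fin 2) ℂ) f = f := by
  simp [invariantSubalgebra, Algebra.mem_iInf, AlgHom.mem_equalizer]

theorem mem_invariantSubalgebra_closure {S : Set (Matrix (Fin 2) (Fin 2) ℂ)ˣ}
    {f : MvPolynomial (Fin 2) ℂ} :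
    f ∈ invariantSubalgebra (Subgroup.closure S) ↔
      ∀ u ∈ S, linSubst (u : Matrix (Fin 2) (Fin 2) ℂ) f = f := by
  rw [mem_invariantSubalgebra]
  refine ⟨fun h u hu => h u (Subgroup.subset_closure hu), fun h u hu => ?_⟩
  induction hu using Subgroup.closure_induction with
  | mem u hu => exact h u hu
  | one => simp [linSubst_one]
  | mul u v _ _ hu hv => simp [linSubst_mul, hu, hv]
  | inv u _ hu =>
    conv_lhs => rw [← hu]
    rw [← AlgHom.comp_apply, ← linSubst_mul]
    simp [linSubst_one]

theorem mem_invariantSubalgebra_tetrahedral {f : MvPolynomial (Fin 2) ℂ} :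
    f ∈ invariantSubalgebra (Subgroup.closure tetrahedralGenerators) ↔
      substI f = f ∧ substJ f = f ∧ substOmega f = f := by
  rw [mem_invariantSubalgebra_closure]
  constructor
  · intro h
    obtain ⟨g₁, h₁⟩ := exists_unit_I
    obtain ⟨g₂, h₂⟩ := exists_unit_J
    obtain ⟨g₃, h₃⟩ := exists_unit_omega
    have e₁ := h g₁ (Or.inl h₁)
    have e₂ := h g₂ (Or.inr (Or.inl h₂))
    have e₃ := h g₃ (Or.inr (Or.inr h₃))
    rw [h₁] at e₁
    rw [h₂] at e₂
    rw [h₃] at e₃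
    exact ⟨e₁, e₂, e₃⟩
  · rintro ⟨h₁, h₂, h₃⟩ u (hu | hu | hu)
    · rw [hu, h₁]
    · rw [hu, h₂]
    · rw [hu, h₃]

theorem substI_X_zero : substI (X 0) = C Complex.I * X 0 := by
  simp [linSubst, Fin.sum_univ_two]

theorem substI_X_one : substI (X 1) = -C Complex.I * X 1 := by
  simp [linSubst, Fin.sum_univ_two]

theorem substJ_X_zero : substJ (X 0) = X 1 := by
  simp [linSubst, Fin.sum_univ_two]

theorem substJ_X_one : substJ (X 1) = -X 0 := by
  simp [linSubst, Fin.sum_univ_two]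

theorem substOmega_X_zero : substOmega (X 0) =
    C (2⁻¹ * (-1 + Complex.I)) * X 0 + C (2⁻¹ * (1 + Complex.I)) * X 1 := by
  simp [linSubst, Fin.sum_univ_two]

theorem substOmega_X_one : substOmega (X 1) =
    C (2⁻¹ * (-1 + Complex.I)) * X 0 - C (2⁻¹ * (1 + Complex.I)) * X 1 := by
  simp [linSubst, Fin.sum_univ_two]
  ring

theorem C_I_sq : (C Complex.I : MvPolynomial (Fin 2) ℂ) ^ 2 = -1 := by
  rw [← map_pow, Complex.I_sq, map_neg, map_one]

theorem substI_mul_X :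
    substI (X 0 * X 1) = X 0 * X 1 := by
  rw [map_mul, substI_X_zero, substI_X_one]
  linear_combination -(X 0 * X 1) * C_I_sq

theorem substJ_mul_X : substJ (X 0 * X 1) = -(X 0 * X 1) := by
  rw [map_mul, substJ_X_zero, substJ_X_one]
  ring

theorem sum_pow_of_sq_eq_neg_one {A : Type*} [CommRing A] {i : A} (hi : i ^ 2 = -1) {d : ℕ}
    (hd : ¬ 4 ∣ d) : 1 + i ^ d + (i ^ d) ^ 2 + (i ^ d) ^ 3 = 0 := by
  obtain h | h | h : d % 4 = 1 ∨ d % 4 = 2 ∨ d % 4 = 3 := by omega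
  all_goals
    have h4 : i ^ 4 = 1 := by linear_combination (i ^ 2 - 1) * hi
    rw [← Nat.div_add_mod d 4, h, pow_add, pow_mul, h4, one_pow]
  · linear_combination (i + 1) * hi
  · linear_combination (i ^ 4 + 1) * hi
  · linear_combination (i ^ 7 - i ^ 5 + i ^ 4 + i ^ 3 - i ^ 2 + 1) * hi

/-- The sum over the cyclic group generated by `diag(i, -i)`. -/
noncomputable def traceI (f : MvPolynomial (Fin 2) ℂ) : MvPolynomial (Fin 2) ℂ :=
  f + substI f + substI (substI f) + substI (substI (substI f))

theorem traceI_mul_pow {d : ℕ} (c : ℂ) (n : ℕ) {z i : MvPolynomial (Fin 2) ℂ}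
    (hz : substI z = i * z) (hsi : substI i = i) :
    traceI (C c * ((X 0 * X 1) ^ n * z ^ d)) =
      (1 + i ^ d + (i ^ d) ^ 2 + (i ^ d) ^ 3) * (C c * ((X 0 * X 1) ^ n * z ^ d)) := by
  have h1 : ∀ g : MvPolynomial (Fin 2) ℂ, substI (C c * ((X 0 * X 1) ^ n * (g * z ^ d))) =
      C c * ((X 0 * X 1) ^ n * (substI g * (i ^ d * z ^ d))) := by
    intro g
    simp only [map_mul substI (C c), map_mul substI ((X 0 * X 1) ^ n), map_pow, substI_mul_X,
      map_mul substI g, hz, mul_pow i, algHom_C, algebraMap_eq]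
  have e1 := h1 1
  have e2 := h1 (i ^ d)
  have e3 := h1 (i ^ d * i ^ d)
  simp only [map_one, one_mul, map_pow, map_mul substI (i ^ d), hsi] at e1 e2 e3
  rw [traceI, e1, e2, ← mul_assoc (i ^ d), e3]
  ring

theorem traceI_add (f g) : traceI (f + g) = traceI f + traceI g := by
  simp only [traceI, map_add]
  ring

/-- Averaging over the quaternion group lands in any subalgebra containing its basic invariants. -/
theorem traceI_add_substJ_mem {B : Subalgebra ℂ (MvPolynomial (Fin 2) ℂ)}
    (hu : X 0 ^ 2 * X 1 ^ 2 ∈ B) (hv : X 0 ^ 4 + X 1 ^ 4 ∈ B)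
    (hw : X 0 * X 1 * (X 0 ^ 4 - X 1 ^ 4) ∈ B) (f : MvPolynomial (Fin 2) ℂ) :
    traceI f + substJ (traceI f) ∈ B := by
  have hC : ∀ c : ℂ, C c ∈ B := fun c => B.algebraMap_mem c
  induction f using MvPolynomial.induction_on' with
  | add f g hf hg =>
    rw [traceI_add, map_add]
    convert add_mem hf hg using 1
    ring
  | monomial m c =>
    have hm : monomial m c = C c * (X 0 ^ m 0 * X 1 ^ m 1) := by
      rw [monomial_eq, Finsupp.prod_fintype _ _ (by simp), Fin.prod_univ_two]
    rw [hm]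
    have key : ∀ (n d : ℕ) (z i : MvPolynomial (Fin 2) ℂ), i ^ 2 = -1 → substI z = i * z →
        substI i = i → (∀ k, (X 0 * X 1) ^ n * z ^ (4 * k) +
          substJ ((X 0 * X 1) ^ n * z ^ (4 * k)) ∈ B) →
        traceI (C c * ((X 0 * X 1) ^ n * z ^ d)) +
          substJ (traceI (C c * ((X 0 * X 1) ^ n * z ^ d))) ∈ B := by
      intro n d z i hi hz hsi hk
      rw [traceI_mul_pow c n hz hsi]
      by_cases hd : 4 ∣ d
      · obtain ⟨k, rfl⟩ := hd
        have h4 : i ^ (4 * k) = 1 := by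
          rw [pow_mul, show i ^ 4 = 1 by linear_combination (i ^ 2 - 1) * hi, one_pow]
        rw [h4, map_mul substJ _ (C c * _), map_mul substJ (C c)]
        convert mul_mem (hC (4 * c)) (hk k) using 1
        rw [map_mul C, map_ofNat]
        simp only [map_add, map_one, map_pow, algHom_C, algebraMap_eq]
        ring
      · rw [sum_pow_of_sq_eq_neg_one hi hd]
        simp
    obtain h | h := le_total (m 1) (m 0)
    · obtain ⟨d, hd⟩ := Nat.exists_eq_add_of_le h
      have := key (m 1) d (X 0) (C Complex.I) C_I_sq substI_X_zero (by simp [linSubst]) fun k => by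
        convert symmetrized_mem hu hv hw (m 1) k using 1
        rw [map_mul, map_pow, map_pow, substJ_mul_X, substJ_X_zero]
        rw [neg_pow]; ring
      convert this using 4 <;> rw [hd] <;> ring
    · obtain ⟨d, hd⟩ := Nat.exists_eq_add_of_le h
      have := key (m 0) d (X 1) (-C Complex.I) (by rw [neg_sq, C_I_sq]) substI_X_one
          (by simp [linSubst]) fun k => by
        convert mul_mem (hC ((-1) ^ m 0)) (symmetrized_mem hu hv hw (m 0) k) using 1
        rw [map_mul, map_pow, map_pow, substJ_mul_X, substJ_X_one,
          neg_pow (X 0 * X 1), Even.neg_pow (n := 4 * k) ⟨2 * k, by ring⟩]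
        have : ((-1 : MvPolynomial (Fin 2) ℂ) ^ m 0) ^ 2 = 1 := by
          rw [← pow_mul, mul_comm, pow_mul]; simp
        simp only [map_pow, map_neg, map_one]
        linear_combination (-((X 0 * X 1) ^ m 0 * X 1 ^ (4 * k))) * this
      convert this using 4 <;> rw [hd] <;> ring

/-- The basic invariant `x²y²` of the quaternion group. -/
noncomputable def quatU : MvPolynomial (Fin 2) ℂ := X 0 ^ 2 * X 1 ^ 2

/-- The basic invariant `x⁴ + y⁴` of the quaternion group. -/
noncomputable def quatV : MvPolynomial (Fin 2) ℂ := X 0 ^ 4 + X 1 ^ 4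

/-- The basic invariant of degree 6 of the binary tetrahedral group. -/
noncomputable def tetT : MvPolynomial (Fin 2) ℂ := X 0 * X 1 * (X 0 ^ 4 - X 1 ^ 4)

/-- The basic invariant of degree 8 of the binary tetrahedral group. -/
noncomputable def tetW : MvPolynomial (Fin 2) ℂ := quatV ^ 2 + 12 * quatU ^ 2

/-- The basic invariant of degree 12 of the binary tetrahedral group. -/
noncomputable def tetChi : MvPolynomial (Fin 2) ℂ := quatV ^ 3 - 36 * quatV * quatU ^ 2

/-- For `s² = -3`, a semi-invariant quartic of the binary tetrahedral group. -/
noncomputable def quartic (s : ℂ) : MvPolynomial (Fin 2) ℂ := quatV + 2 * C s * quatU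

theorem tet_relation : tetChi ^ 2 - tetW ^ 3 + 108 * tetT ^ 4 = 0 := by
  simp only [tetChi, tetW, tetT, quatU, quatV]
  ring

theorem C_sq_of_sq {s : ℂ} (hs : s ^ 2 = -3) : (C s : MvPolynomial (Fin 2) ℂ) ^ 2 = -3 := by
  rw [← map_pow, hs, map_neg, map_ofNat]

theorem quartic_mul_quartic {s : ℂ} (hs : s ^ 2 = -3) : quartic s * quartic (-s) = tetW := by
  simp only [quartic, tetW, map_neg]
  linear_combination (-4 * quatU ^ 2) * C_sq_of_sq hs

theorem quartic_pow_three {s : ℂ} (hs : s ^ 2 = -3) :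
    quartic s ^ 3 = tetChi + 6 * C s * tetT ^ 2 := by
  have h : tetT ^ 2 = quatU * (quatV ^ 2 - 4 * quatU ^ 2) := by
    simp only [tetT, quatU, quatV]
    ring
  rw [h]
  simp only [quartic, tetChi]
  linear_combination (12 * quatV * quatU ^ 2 + 8 * C s * quatU ^ 3) * C_sq_of_sq hs

theorem tet_invariant_substI {f : MvPolynomial (Fin 2) ℂ}
    (hf : f = tetT ∨ f = tetW ∨ f = tetChi) : substI f = f := by
  have hu : substI quatU = quatU := by
    rw [quatU, ← mul_pow, map_pow, substI_mul_X]
  have h4 : (C Complex.I : MvPolynomial (Fin 2) ℂ) ^ 4 = 1 := by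
    linear_combination (C Complex.I ^ 2 - 1) * C_I_sq
  have hv : substI quatV = quatV := by
    simp only [quatV, map_add, map_pow, substI_X_zero, substI_X_one]
    linear_combination (X 0 ^ 4 + X 1 ^ 4) * h4
  obtain rfl | rfl | rfl := hf
  · rw [tetT, map_mul, substI_mul_X]
    simp only [map_sub, map_pow, substI_X_zero, substI_X_one]
    linear_combination X 0 * X 1 * (X 0 ^ 4 - X 1 ^ 4) * h4
  · simp only [tetW, map_add, map_mul, map_pow, hu, hv, map_ofNat]
  · simp only [tetChi, map_sub, map_mul, map_pow, hu, hv, map_ofNat]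

theorem tet_invariant_substJ {f : MvPolynomial (Fin 2) ℂ}
    (hf : f = tetT ∨ f = tetW ∨ f = tetChi) : substJ f = f := by
  obtain rfl | rfl | rfl := hf <;>
  · simp only [tetT, tetW, tetChi, quatU, quatV, map_add, map_sub, map_mul, map_pow,
      substJ_X_zero, substJ_X_one, map_ofNat]
    ring

theorem substOmega_quatU : substOmega quatU = C (-1 / 4) * (quatV + 2 * quatU) := by
  have h4 : (2⁻¹ * (-1 + Complex.I)) ^ 4 = (-1 / 4 : ℂ) := by
    linear_combination (Complex.I ^ 2 - 4 * Complex.I + 5) / 16 * Complex.I_sq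
  have h2 : (2⁻¹ * (1 + Complex.I)) ^ 2 = -(2⁻¹ * (-1 + Complex.I) : ℂ) ^ 2 := by
    linear_combination 2⁻¹ * Complex.I_sq
  have h2' := congrArg (C : ℂ → MvPolynomial (Fin 2) ℂ) h2
  simp only [map_neg, map_pow] at h2'
  rw [← h4, map_pow, quatU, quatV, map_mul, map_pow, map_pow, substOmega_X_zero,
    substOmega_X_one]
  set a := (C (2⁻¹ * (-1 + Complex.I)) : MvPolynomial (Fin 2) ℂ)
  set b := (C (2⁻¹ * (1 + Complex.I)) : MvPolynomial (Fin 2) ℂ)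
  linear_combination (-2 * a ^ 2 * X 0 ^ 2 * X 1 ^ 2 + (b ^ 2 - a ^ 2) * X 1 ^ 4) * h2'

theorem substOmega_quatV : substOmega quatV = C (-1 / 2) * (quatV - 6 * quatU) := by
  have h4 : 2 * (2⁻¹ * (-1 + Complex.I)) ^ 4 = (-1 / 2 : ℂ) := by
    linear_combination (Complex.I ^ 2 - 4 * Complex.I + 5) / 8 * Complex.I_sq
  have h2 : (2⁻¹ * (1 + Complex.I)) ^ 2 = -(2⁻¹ * (-1 + Complex.I) : ℂ) ^ 2 := by
    linear_combination 2⁻¹ * Complex.I_sq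
  have h2' := congrArg (C : ℂ → MvPolynomial (Fin 2) ℂ) h2
  simp only [map_neg, map_pow] at h2'
  rw [← h4, map_mul, map_ofNat, map_pow, quatU, quatV, map_add, map_pow, map_pow,
    substOmega_X_zero, substOmega_X_one]
  set a := (C (2⁻¹ * (-1 + Complex.I)) : MvPolynomial (Fin 2) ℂ)
  set b := (C (2⁻¹ * (1 + Complex.I)) : MvPolynomial (Fin 2) ℂ)
  linear_combination (12 * a ^ 2 * X 0 ^ 2 * X 1 ^ 2 + 2 * (b ^ 2 - a ^ 2) * X 1 ^ 4) * h2'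

theorem substOmega_tetT : substOmega tetT = tetT := by
  have h2 : (2⁻¹ * (1 + Complex.I)) ^ 2 = -(2⁻¹ * (-1 + Complex.I) : ℂ) ^ 2 := by
    linear_combination 2⁻¹ * Complex.I_sq
  have h8 : 8 * (2⁻¹ * (-1 + Complex.I)) ^ 5 * (2⁻¹ * (1 + Complex.I)) = (1 : ℂ) := by
    have h4 : 4 * (2⁻¹ * (-1 + Complex.I)) ^ 4 = (-1 : ℂ) := by
      linear_combination (Complex.I ^ 2 - 4 * Complex.I + 5) / 4 * Complex.I_sq
    have h1 : 2 * (2⁻¹ * (-1 + Complex.I)) * (2⁻¹ * (1 + Complex.I)) = (-1 : ℂ) := by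
      linear_combination 2⁻¹ * Complex.I_sq
    linear_combination 4 * (2⁻¹ * (-1 + Complex.I)) ^ 4 * h1 - h4
  have h2' := congrArg (C : ℂ → MvPolynomial (Fin 2) ℂ) h2
  have h8' := congrArg (C : ℂ → MvPolynomial (Fin 2) ℂ) h8
  rw [map_neg, map_pow, map_pow] at h2'
  rw [map_mul, map_mul, map_pow, map_ofNat, map_one] at h8'
  rw [tetT, map_mul, map_mul, map_sub, map_pow, map_pow, substOmega_X_zero, substOmega_X_one]
  set a := (C (2⁻¹ * (-1 + Complex.I)) : MvPolynomial (Fin 2) ℂ)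
  set b := (C (2⁻¹ * (1 + Complex.I)) : MvPolynomial (Fin 2) ℂ)
  linear_combination X 0 * X 1 * (X 0 ^ 4 - X 1 ^ 4) * h8' -
    8 * a * b * X 0 * X 1 * (b ^ 2 - a ^ 2) * X 1 ^ 4 * h2'

theorem substOmega_quartic {s : ℂ} (hs : s ^ 2 = -3) :
    substOmega (quartic s) = C (-(1 + s) / 2) * quartic s := by
  have h1 : (C (-1 / 2) : MvPolynomial (Fin 2) ℂ) = 2 * C (-1 / 4) := by
    rw [← map_ofNat C, ← map_mul]
    norm_num
  have h2 : (C (-(1 + s) / 2) : MvPolynomial (Fin 2) ℂ) = 2 * C (-1 / 4) * (1 + C s) := by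
    rw [← map_ofNat C, ← map_one C, ← map_add, ← map_mul, ← map_mul]
    congr 1
    ring
  simp only [quartic, map_add, map_mul, substOmega_quatU, substOmega_quatV, map_ofNat, algHom_C,
    algebraMap_eq, h1, h2]
  linear_combination (-4 * C (-1 / 4) * quatU) * C_sq_of_sq hs

theorem exists_sq_eq_neg_three : ∃ s : ℂ, s ^ 2 = -3 :=
  IsAlgClosed.exists_pow_nat_eq _ two_pos

theorem tet_invariant_substOmega {f : MvPolynomial (Fin 2) ℂ}
    (hf : f = tetT ∨ f = tetW ∨ f = tetChi) : substOmega f = f := by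
  have h1 : (C (-1 / 2) : MvPolynomial (Fin 2) ℂ) = 2 * C (-1 / 4) := by
    rw [← map_ofNat C, ← map_mul]
    norm_num
  have h4 : 4 * (C (-1 / 4) : MvPolynomial (Fin 2) ℂ) = -1 := by
    rw [← map_ofNat C, ← map_mul, ← map_one C, ← map_neg]
    norm_num
  obtain rfl | rfl | rfl := hf
  · exact substOmega_tetT
  · simp only [tetW, map_add, map_mul, map_pow, substOmega_quatU, substOmega_quatV, map_ofNat, h1]
    linear_combination (quatV ^ 2 + 12 * quatU ^ 2) * (4 * C (-1 / 4) - 1) * h4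
  · simp only [tetChi, map_sub, map_mul, map_pow, substOmega_quatU, substOmega_quatV, map_ofNat, h1]
    have h64 : 64 * (C (-1 / 4) : MvPolynomial (Fin 2) ℂ) ^ 3 = -1 := by
      linear_combination ((4 * C (-1 / 4)) ^ 2 - 4 * C (-1 / 4) + 1) * h4
    linear_combination (-(quatV ^ 3 - 36 * quatV * quatU ^ 2)) * h64

/-- The sum over the cyclic group generated by the element of order three. -/
noncomputable def traceOmega (f : MvPolynomial (Fin 2) ℂ) : MvPolynomial (Fin 2) ℂ :=
  f + substOmega f + substOmega (substOmega f)

theorem traceOmega_add (f g) : traceOmega (f + g) = traceOmega f + traceOmega g := by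
  simp only [traceOmega, map_add]
  ring

theorem traceOmega_mul_pow_mem {A : Subalgebra ℂ (MvPolynomial (Fin 2) ℂ)}
    {z h : MvPolynomial (Fin 2) ℂ} {ω : ℂ} (hω : ω ^ 2 + ω + 1 = 0)
    (hz : substOmega z = C ω * z) (hz3 : z ^ 3 ∈ A) (hh : h ∈ A) (hT : substOmega h = h) (d : ℕ) :
    traceOmega (h * z ^ d) ∈ A := by
  have hω3 : ω ^ 3 = 1 := by linear_combination (ω - 1) * hω
  have htrace : traceOmega (h * z ^ d) = C (1 + ω ^ d + (ω ^ d) ^ 2) * (h * z ^ d) := by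
    simp only [traceOmega, map_mul substOmega, map_pow, hz, hT, algHom_C, algebraMap_eq, map_add,
      map_one]
    ring
  rw [htrace]
  obtain hd | hd | hd : d % 3 = 0 ∨ d % 3 = 1 ∨ d % 3 = 2 := by omega
  · rw [← Nat.div_add_mod d 3, hd, add_zero, pow_mul z]
    exact mul_mem (A.algebraMap_mem _) (mul_mem hh (pow_mem hz3 _))
  · rw [show 1 + ω ^ d + (ω ^ d) ^ 2 = 0 by
      rw [← Nat.div_add_mod d 3, hd, pow_add, pow_mul, hω3, one_pow]
      linear_combination hω]
    simp
  · rw [show 1 + ω ^ d + (ω ^ d) ^ 2 = 0 by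
      rw [← Nat.div_add_mod d 3, hd, pow_add, pow_mul, hω3, one_pow]
      linear_combination hω + ω * hω3]
    simp

theorem traceOmega_aeval_mem {A : Subalgebra ℂ (MvPolynomial (Fin 2) ℂ)} (ht : tetT ∈ A)
    (hw : tetW ∈ A) (hchi : tetChi ∈ A) {s : ℂ} (hs : s ^ 2 = -3) (F : MvPolynomial (Fin 3) ℂ) :
    traceOmega (aeval ![quartic s, quartic (-s), tetT] F) ∈ A := by
  have hs' : (-s) ^ 2 = -3 := by rw [neg_sq, hs]
  have cube : ∀ s : ℂ, s ^ 2 = -3 → quartic s ^ 3 ∈ A := fun s hs => by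
    rw [quartic_pow_three hs]
    exact add_mem hchi (mul_mem (mul_mem (ofNat_mem A 6) (A.algebraMap_mem s)) (pow_mem ht 2))
  have root : ∀ s : ℂ, s ^ 2 = -3 → (-(1 + s) / 2) ^ 2 + -(1 + s) / 2 + 1 = 0 := fun s hs => by
    linear_combination hs / 4
  have fixed : ∀ (c : ℂ) (n k : ℕ), C c * (tetW ^ n * tetT ^ k) ∈ A ∧
      substOmega (C c * (tetW ^ n * tetT ^ k)) = C c * (tetW ^ n * tetT ^ k) := fun c n k => by
    refine ⟨mul_mem (A.algebraMap_mem c) (mul_mem (pow_mem hw n) (pow_mem ht k)), ?_⟩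
    rw [map_mul, map_mul, map_pow, map_pow, tet_invariant_substOmega (.inr (.inl rfl)),
      substOmega_tetT, algHom_C, algebraMap_eq]
  induction F using MvPolynomial.induction_on' with
  | add f g hf hg =>
    rw [map_add, traceOmega_add]
    exact add_mem hf hg
  | monomial m c =>
    rw [aeval_monomial, Finsupp.prod_fintype _ _ (by simp), Fin.prod_univ_three]
    simp only [Matrix.cons_val_zero, Matrix.cons_val_one, Matrix.cons_val, algebraMap_eq]
    obtain h | h := le_total (m 1) (m 0)
    · obtain ⟨d, hd⟩ := Nat.exists_eq_add_of_le h
      obtain ⟨h₁, h₂⟩ := fixed c (m 1) (m 2)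
      convert traceOmega_mul_pow_mem (root s hs) (substOmega_quartic hs) (cube s hs) h₁ h₂ d using 2
      rw [hd, ← quartic_mul_quartic hs]
      ring
    · obtain ⟨d, hd⟩ := Nat.exists_eq_add_of_le h
      obtain ⟨h₁, h₂⟩ := fixed c (m 0) (m 2)
      convert traceOmega_mul_pow_mem (root (-s) hs') (substOmega_quartic hs') (cube (-s) hs')
        h₁ h₂ d using 2
      rw [hd, ← quartic_mul_quartic hs]
      ring

/-- The invariants of the binary tetrahedral group are generated by the basic invariants of
degrees 6, 8 and 12. -/
theorem invariantSubalgebra_le {A : Subalgebra ℂ (MvPolynomial (Fin 2) ℂ)} (ht : tetT ∈ A)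
    (hw : tetW ∈ A) (hchi : tetChi ∈ A) :
    invariantSubalgebra (Subgroup.closure tetrahedralGenerators) ≤ A := by
  intro f hf
  obtain ⟨h₁, h₂, h₃⟩ := mem_invariantSubalgebra_tetrahedral.1 hf
  obtain ⟨s, hs⟩ := exists_sq_eq_neg_three
  have hs0 : s ≠ 0 := by rintro rfl; norm_num at hs
  set B := (aeval ![quartic s, quartic (-s), tetT] :
    MvPolynomial (Fin 3) ℂ →ₐ[ℂ] MvPolynomial (Fin 2) ℂ).range
  have hB : ∀ i, ![quartic s, quartic (-s), tetT] i ∈ B := fun i => ⟨X i, aeval_X _ i⟩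
  have hp : quartic s ∈ B := hB 0
  have hq : quartic (-s) ∈ B := hB 1
  have hv : quatV ∈ B := by
    convert B.smul_mem (add_mem hp hq) (2⁻¹ : ℂ) using 1
    rw [show quartic s + quartic (-s) = (2 : ℂ) • quatV by
      rw [smul_eq_C_mul, map_ofNat]; simp only [quartic, map_neg]; ring, smul_smul]
    norm_num
  have hu : quatU ∈ B := by
    convert B.smul_mem (sub_mem hp hq) ((4 * s)⁻¹ : ℂ) using 1
    rw [show quartic s - quartic (-s) = (4 * s) • quatU by
      rw [smul_eq_C_mul, map_mul, map_ofNat]; simp only [quartic, map_neg]; ring, smul_smul,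
      inv_mul_cancel₀ (by simpa using hs0), one_smul]
  obtain ⟨F, hF⟩ := traceI_add_substJ_mem hu hv (hB 2) f
  have hmem := traceOmega_aeval_mem ht hw hchi hs F
  have htr : traceI f = 4 * f := by
    rw [traceI, h₁, h₁, h₁]
    ring
  replace hF : aeval _ F = _ := hF
  rw [hF, htr, map_mul, map_ofNat, h₂, traceOmega, map_add, map_mul, map_ofNat, h₃, map_add,
    map_mul, map_ofNat, h₃] at hmem
  convert A.smul_mem hmem (24⁻¹ : ℂ) using 1
  rw [show 4 * f + 4 * f + (4 * f + 4 * f) + (4 * f + 4 * f) = (24 : ℂ) • f by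
    rw [smul_eq_C_mul, map_ofNat]; ring, smul_smul]
  norm_num

/-- The parametrization of the Brieskorn variety `V(2,3,4)` by the basic invariants. -/
noncomputable def brieskornHom (c : ℂ) : MvPolynomial (Fin 3) ℂ →ₐ[ℂ] MvPolynomial (Fin 2) ℂ :=
  aeval ![tetChi, -tetW, C c * tetT]

theorem brieskornHom_range {c : ℂ} (hc : c ≠ 0) :
    (brieskornHom c).range = invariantSubalgebra (Subgroup.closure tetrahedralGenerators) := by
  have basic : ∀ f, f = tetT ∨ f = tetW ∨ f = tetChi →
      f ∈ invariantSubalgebra (Subgroup.closure tetrahedralGenerators) := fun f hf =>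
    mem_invariantSubalgebra_tetrahedral.2
      ⟨tet_invariant_substI hf, tet_invariant_substJ hf, tet_invariant_substOmega hf⟩
  have hmem : ∀ i, ![tetChi, -tetW, C c * tetT] i ∈ (brieskornHom c).range := fun i =>
    ⟨X i, aeval_X _ i⟩
  apply le_antisymm
  · rw [brieskornHom, ← Algebra.adjoin_range_eq_range_aeval, Algebra.adjoin_le_iff]
    rintro _ ⟨i, rfl⟩
    fin_cases i
    · exact basic _ (.inr (.inr rfl))
    · exact neg_mem (basic _ (.inr (.inl rfl)))
    · exact mul_mem (Subalgebra.algebraMap_mem _ c) (basic _ (.inl rfl))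
  · refine invariantSubalgebra_le ?_ (neg_mem_iff.1 (hmem 1)) (hmem 0)
    convert (brieskornHom c).range.smul_mem (hmem 2) c⁻¹ using 1
    simp [← smul_eq_C_mul, smul_smul, hc]

/-- Polynomials in the last two variables. -/
noncomputable def lastTwo : Polynomial (Polynomial ℂ) →+* MvPolynomial (Fin 3) ℂ :=
  Polynomial.eval₂RingHom (Polynomial.aeval (X 1)).toRingHom (X 2)

theorem brieskornHom_lastTwo_injective {c : ℂ} (hc : c ≠ 0) {a : Polynomial (Polynomial ℂ)}
    (ha : brieskornHom c (lastTwo a) = 0) : a = 0 := by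
  by_contra hne
  obtain ⟨b, hab, hb⟩ := Polynomial.exists_eq_pow_rootMultiplicity_mul_and_not_dvd a hne 0
  rw [Polynomial.C_0, sub_zero] at hab hb
  have hX : brieskornHom c (lastTwo Polynomial.X) = C c * tetT := by
    simp [brieskornHom, lastTwo]
  have htT : tetT ≠ 0 := fun h => by
    have := congrArg (MvPolynomial.eval ![2, 1]) h
    norm_num [tetT] at this
  have hb0 : brieskornHom c (lastTwo b) = 0 := by
    rw [hab, map_mul, map_mul, map_pow, map_pow, hX] at ha
    exact (mul_eq_zero.1 ha).resolve_left (pow_ne_zero _ (mul_ne_zero (by simpa using hc) htT))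
  let ρ : MvPolynomial (Fin 2) ℂ →ₐ[ℂ] Polynomial ℂ := aeval ![Polynomial.X, 0]
  have hρ : (ρ.toRingHom.comp ((brieskornHom c).toRingHom.comp lastTwo)) =
      (Polynomial.compRingHom (-Polynomial.X ^ 8)).comp Polynomial.constantCoeff := by
    ext1
    · ext1
      · ext1 z
        simp [ρ, brieskornHom, lastTwo]
      · simp [ρ, brieskornHom, lastTwo, tetW, quatU, quatV, ← pow_mul]
    · simp [ρ, brieskornHom, lastTwo, tetT]
  have h0 : (b.coeff 0).comp (-Polynomial.X ^ 8) = 0 := by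
    have := DFunLike.congr_fun hρ b
    simp only [RingHom.comp_apply] at this
    change ρ (brieskornHom c (lastTwo b)) = (b.coeff 0).comp _ at this
    rw [← this, hb0, map_zero]
  apply hb
  rw [Polynomial.X_dvd_iff]
  rcases Polynomial.comp_eq_zero_iff.1 h0 with h | ⟨-, h⟩
  · exact h
  · have := congrArg Polynomial.natDegree h
    simp at this

theorem exists_sub_mem_span (g : MvPolynomial (Fin 3) ℂ) :
    ∃ a b, g - (lastTwo a + X 0 * lastTwo b) ∈
      Ideal.span {(X 0 ^ 2 + X 1 ^ 3 + X 2 ^ 4 : MvPolynomial (Fin 3) ℂ)} := by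
  have h1 : lastTwo (Polynomial.C Polynomial.X) = X 1 := by simp [lastTwo]
  have h2 : lastTwo Polynomial.X = X 2 := by simp [lastTwo]
  induction g using MvPolynomial.induction_on with
  | C c =>
    refine ⟨Polynomial.C (Polynomial.C c), 0, ?_⟩
    simp [lastTwo, algebraMap_eq]
  | add f g hf hg =>
    obtain ⟨a, b, h⟩ := hf
    obtain ⟨a', b', h'⟩ := hg
    refine ⟨a + a', b + b', ?_⟩
    convert add_mem h h' using 1
    simp only [map_add]
    ring
  | mul_X g i hg =>
    obtain ⟨a, b, h⟩ := hg
    have h' := Ideal.mul_mem_left _ (X i) h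
    fin_cases i
    · refine ⟨-((Polynomial.C (Polynomial.X : Polynomial ℂ) ^ 3 + Polynomial.X ^ 4) * b), a, ?_⟩
      convert add_mem h' (Ideal.mul_mem_left _ (lastTwo b)
        (Ideal.mem_span_singleton_self (X 0 ^ 2 + X 1 ^ 3 + X 2 ^ 4))) using 1
      simp only [map_mul, map_neg, map_add, map_pow, h1, h2, Fin.zero_eta]
      ring
    · refine ⟨Polynomial.C Polynomial.X * a, Polynomial.C Polynomial.X * b, ?_⟩
      convert h' using 1
      simp only [map_mul, h1, Fin.mk_one]
      ring
    · refine ⟨Polynomial.X * a, Polynomial.X * b, ?_⟩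
      convert h' using 1
      simp only [map_mul, h2, Fin.reduceFinMk]
      ring

theorem brieskornHom_ker {c : ℂ} (hc : c ^ 4 = 108) :
    RingHom.ker (brieskornHom c) =
      Ideal.span {(X 0 ^ 2 + X 1 ^ 3 + X 2 ^ 4 : MvPolynomial (Fin 3) ℂ)} := by
  have hc0 : c ≠ 0 := by rintro rfl; norm_num at hc
  have hle : Ideal.span {(X 0 ^ 2 + X 1 ^ 3 + X 2 ^ 4 : MvPolynomial (Fin 3) ℂ)} ≤
      RingHom.ker (brieskornHom c) := by
    rw [Ideal.span_singleton_le_iff_mem, RingHom.mem_ker]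
    have hC : (C c : MvPolynomial (Fin 2) ℂ) ^ 4 = 108 := by rw [← map_pow, hc, map_ofNat]
    simp only [brieskornHom, map_add, map_pow, aeval_X, Matrix.cons_val_zero, Matrix.cons_val_one,
      Matrix.cons_val]
    linear_combination tet_relation + tetT ^ 4 * hC
  refine le_antisymm (fun g hg => ?_) hle
  obtain ⟨a, b, hab⟩ := exists_sub_mem_span g
  have hsum : brieskornHom c (lastTwo a) + tetChi * brieskornHom c (lastTwo b) = 0 := by
    have h := hle hab
    rw [RingHom.mem_ker, map_sub, RingHom.mem_ker.1 hg, zero_sub, neg_eq_zero, map_add,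
      map_mul] at h
    rwa [show brieskornHom c (X 0) = tetChi by simp [brieskornHom]] at h
  -- a symmetry fixing the invariants of degrees 6 and 8 and negating that of degree 12
  obtain ⟨l, hl⟩ : ∃ l : ℂ, l ^ 4 = -1 := IsAlgClosed.exists_pow_nat_eq _ four_pos
  have hl' : (C l : MvPolynomial (Fin 2) ℂ) ^ 4 = -1 := by rw [← map_pow, hl, map_neg, map_one]
  let σ : MvPolynomial (Fin 2) ℂ →ₐ[ℂ] MvPolynomial (Fin 2) ℂ :=
    aeval ![C l * X 0, C l ^ 3 * X 1]
  have hσ0 : σ (X 0) = C l * X 0 := by simp [σ]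
  have hσ1 : σ (X 1) = C l ^ 3 * X 1 := by simp [σ]
  have hσu : σ quatU = quatU := by
    simp only [quatU, map_mul, map_pow, hσ0, hσ1]
    linear_combination (X 0 ^ 2 * X 1 ^ 2) * (C l ^ 4 - 1) * hl'
  have hσv : σ quatV = -quatV := by
    simp only [quatV, map_add, map_pow, hσ0, hσ1]
    linear_combination (X 0 ^ 4 + X 1 ^ 4 * (C l ^ 8 - C l ^ 4 + 1)) * hl'
  have hσt : σ tetT = tetT := by
    simp only [tetT, map_mul, map_sub, map_pow, hσ0, hσ1]
    linear_combination (X 0 * X 1) * (X 0 ^ 4 * (C l ^ 4 - 1) -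
      X 1 ^ 4 * (C l ^ 12 - C l ^ 8 + C l ^ 4 - 1)) * hl'
  have hσw : σ tetW = tetW := by
    simp only [tetW, map_add, map_mul, map_pow, hσu, hσv, map_ofNat]
    ring
  have hσchi : σ tetChi = -tetChi := by
    simp only [tetChi, map_sub, map_mul, map_pow, hσu, hσv, map_ofNat]
    ring
  have hfix : ∀ p, σ (brieskornHom c (lastTwo p)) = brieskornHom c (lastTwo p) := by
    have : σ.toRingHom.comp ((brieskornHom c).toRingHom.comp lastTwo) =
        (brieskornHom c).toRingHom.comp lastTwo := by
      ext1
      · ext1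
        · ext1 z
          simp [brieskornHom, lastTwo]
        · simp [brieskornHom, lastTwo, hσw]
      · simp [brieskornHom, lastTwo, hσt]
    exact fun p => DFunLike.congr_fun this p
  have hdiff : brieskornHom c (lastTwo a) - tetChi * brieskornHom c (lastTwo b) = 0 := by
    have h := congrArg σ hsum
    rw [map_add, map_mul, hfix, hfix, hσchi, map_zero] at h
    linear_combination h
  have h2 : (2 : MvPolynomial (Fin 2) ℂ) ≠ 0 := two_ne_zero
  have ha : a = 0 := brieskornHom_lastTwo_injective hc0
    ((mul_eq_zero.1 (show 2 * brieskornHom c (lastTwo a) = 0 by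
      linear_combination hsum + hdiff)).resolve_left h2)
  have hchi0 : tetChi ≠ 0 := fun h => by
    have := congrArg (MvPolynomial.eval ![1, 0]) h
    norm_num [tetChi, quatU, quatV] at this
  have hb : b = 0 := by
    rw [ha, map_zero, map_zero, zero_add] at hsum
    exact brieskornHom_lastTwo_injective hc0 ((mul_eq_zero.1 hsum).resolve_left hchi0)
  simpa [ha, hb] using hab

/-- Let `2T ⊂ GL₂(ℂ)` be the binary tetrahedral group `Δ'(2,3,3)`, the subgroup of order 24
generated by `[[i,0],[0,−i]]`, `[[0,1],[−1,0]]` and `(1/2)[[−1+i,1+i],[−1+i,−1−i]]`, acting on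
`ℂ[x,y]` by linear substitution.  Then the invariant subalgebra `ℂ[x,y]^{2T}` is isomorphic as
a ℂ-algebra to `ℂ[z₁,z₂,z₃]/(z₁² + z₂³ + z₃⁴)`, the coordinate ring of the Brieskorn variety
`V(2,3,4)`.  Hence `V(2,3,4) ≅ ℂ²/Δ'(2,3,3)`. -/
theorem brieskorn_V234_iso_C2_mod_binaryTetrahedral
    (T2 : Subgroup (Matrix (Fin 2) (Fin 2) ℂ)ˣ)
    (hT2 : T2 = Subgroup.closure
      {u : (Matrix (Fin 2) (Fin 2) ℂ)ˣ |
        (u : Matrix (Fin 2) (Fin 2) ℂ) = !![Complex.I, 0; 0, -Complex.I] ∨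
        (u : Matrix (Fin 2) (Fin 2) ℂ) = !![0, 1; -1, 0] ∨
        (u : Matrix (Fin 2) (Fin 2) ℂ) =
          (2⁻¹ : ℂ) • !![-1 + Complex.I, 1 + Complex.I; -1 + Complex.I, -1 - Complex.I]}) :
    Nat.card T2 = 24 ∧
      Nonempty
        (invariantSubalgebra T2 ≃ₐ[ℂ]
          (MvPolynomial (Fin 3) ℂ ⧸
            Ideal.span {(X 0 ^ 2 + X 1 ^ 3 + X 2 ^ 4 : MvPolynomial (Fin 3) ℂ)})) := by
  change T2 = Subgroup.closure tetrahedralGenerators at hT2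
  subst hT2
  refine ⟨card_closure_tetrahedralGenerators, ?_⟩
  obtain ⟨c, hc⟩ : ∃ c : ℂ, c ^ 4 = 108 := IsAlgClosed.exists_pow_nat_eq _ four_pos
  have hc0 : c ≠ 0 := by rintro rfl; norm_num at hc
  have hker : RingHom.ker (brieskornHom c).rangeRestrict =
      Ideal.span {(X 0 ^ 2 + X 1 ^ 3 + X 2 ^ 4 : MvPolynomial (Fin 3) ℂ)} := by
    rw [← brieskornHom_ker hc]
    exact AlgHom.ker_rangeRestrict _
  exact ⟨(Subalgebra.equivOfEq _ _ (brieskornHom_range hc0).symm).trans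
    ((Ideal.quotientKerAlgEquivOfSurjective
      (brieskornHom c).rangeRestrict_surjective).symm.trans
      (Ideal.quotientEquivAlgOfEq ℂ hker))⟩
end
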